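/- Let a, b, l₁, l₂ be positive integers with gcd(l₁,l₂)=1, gcd(l₁,b)=1, and gcd(l₂,a)=1. Let n, m₁, m₂ be integers with 0 ≤ m₁ < l₁ and 0 ≤ m₂ < l₂. If a·l₁·l₂ divides a·l₁·m₂ + b·l₁·l₂·n − b·l₂·m₁, then m₁ = 0 and m₂ = 0. -/

import Mathlib

/- STATEMENT 1: key arithmetic step: if 0 ≤ m₁ < l₁, 0 ≤ m₂ < l₂ and
a·l₁·l₂ ∣ a·l₁·m₂ + b·l₁·l₂·n − b·l₂·m₁, then m₁ = 0 and m₂ = 0. -/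
theorem stmt1 (a b l₁ l₂ : ℕ) (ha : 0 < a) (hb : 0 < b) (hl₁ : 0 < l₁) (hl₂ : 0 < l₂)
    (hl₁l₂ : Nat.gcd l₁ l₂ = 1) (hl₁b : Nat.gcd l₁ b = 1) (hl₂a : Nat.gcd l₂ a = 1)
    (n m₁ m₂ : ℤ) (hm₁ : 0 ≤ m₁) (hm₁' : m₁ < (l₁ : ℤ)) (hm₂ : 0 ≤ m₂) (hm₂' : m₂ < (l₂ : ℤ))
    (hdvd : ((a : ℤ) * l₁ * l₂) ∣
      ((a : ℤ) * l₁ * m₂ + (b : ℤ) * l₁ * l₂ * n - (b : ℤ) * l₂ * m₁)) :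
    m₁ = 0 ∧ m₂ = 0 := by
  obtain ⟨k, hk⟩ := hdvd
  have h₁₂ : IsCoprime (l₁ : ℤ) l₂ := Nat.isCoprime_iff_coprime.mpr hl₁l₂
  have h₁b : IsCoprime (l₁ : ℤ) b := Nat.isCoprime_iff_coprime.mpr hl₁b
  have h₂a : IsCoprime (l₂ : ℤ) a := Nat.isCoprime_iff_coprime.mpr hl₂a
  have h₁ : (l₁ : ℤ) ∣ m₁ := (h₁b.mul_right h₁₂).dvd_of_dvd_mul_left
    ⟨a * m₂ + b * l₂ * n - a * l₂ * k, by linear_combination -hk⟩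
  have h₂ : (l₂ : ℤ) ∣ m₂ := (h₂a.mul_right h₁₂.symm).dvd_of_dvd_mul_left
    ⟨a * l₁ * k - b * l₁ * n + b * m₁, by linear_combination hk⟩
  exact ⟨Int.eq_zero_of_dvd_of_nonneg_of_lt hm₁ hm₁' h₁,
    Int.eq_zero_of_dvd_of_nonneg_of_lt hm₂ hm₂' h₂⟩
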